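/- arXiv:1502.01870 — 2 statements merged into one kernel-verified Lean document; each statement's English description precedes it below -/
import Mathlib

section
/- Let n = 1, so all matrices are 2×2. Let K be a real 2×2 matrix with 0 ≤ det K ≤ 1 and α a real symmetric positive semidefinite 2×2 matrix such that the pair (K,α) satisfies the positivity condition. Then the pair (K,α) satisfies the CP condition, i.e. both α + i(Δ − KΔKᵀ) and α − i(Δ − KΔKᵀ) are positive semidefinite. -/
open Matrix Complex
open scoped ComplexOrder

/-- The standard symplectic form for one mode. -/
noncomputable def Δ₂ : Matrix (Fin 2) (Fin 2) ℝ := !![0, 1; -1, 0]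

/-- The one-mode transposition `diag(1,-1)`. -/
noncomputable def T₂ : Matrix (Fin 2) (Fin 2) ℝ := !![1, 0; 0, -1]

/-- `σ ≥ ± iΔ` : both `σ + iΔ` and `σ - iΔ` (as complex matrices) are PSD. -/
noncomputable def GeqPMiDelta (σ : Matrix (Fin 2) (Fin 2) ℝ) : Prop :=
  (σ.map (Complex.ofReal) + Complex.I • Δ₂.map (Complex.ofReal)).PosSemidef ∧
  (σ.map (Complex.ofReal) - Complex.I • Δ₂.map (Complex.ofReal)).PosSemidef

/-- A quantum covariance matrix: real symmetric with `σ ≥ ± iΔ`. -/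
noncomputable def IsQCM (σ : Matrix (Fin 2) (Fin 2) ℝ) : Prop :=
  σ.IsSymm ∧ GeqPMiDelta σ

/-- The positivity condition: `K σ Kᵀ + α ≥ ± iΔ` for every quantum covariance matrix `σ`. -/
noncomputable def PosCond (K α : Matrix (Fin 2) (Fin 2) ℝ) : Prop :=
  ∀ σ : Matrix (Fin 2) (Fin 2) ℝ, IsQCM σ → GeqPMiDelta (K * σ * Kᵀ + α)

/-- The CP condition: both `α + i(Δ - KΔKᵀ)` and `α - i(Δ - KΔKᵀ)` are PSD. -/
noncomputable def CPCond (K α : Matrix (Fin 2) (Fin 2) ℝ) : Prop :=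
  (α.map (Complex.ofReal) + Complex.I • ((Δ₂ - K * Δ₂ * Kᵀ).map (Complex.ofReal))).PosSemidef ∧
  (α.map (Complex.ofReal) - Complex.I • ((Δ₂ - K * Δ₂ * Kᵀ).map (Complex.ofReal))).PosSemidef

/-- A Hermitian `2 × 2` matrix is positive semidefinite iff its diagonal entries and determinant
are nonnegative. -/
theorem posSemidef_fin_two_iff (a x b c : ℝ) :
    (!![(a : ℂ), x + I * c; x - I * c, b]).PosSemidef ↔
      0 ≤ a ∧ 0 ≤ b ∧ x ^ 2 + c ^ 2 ≤ a * b := by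
  constructor
  · intro h
    have h0 := h.diag_nonneg (i := 0)
    have h1 := h.diag_nonneg (i := 1)
    have h2 := h.det_nonneg
    rw [Matrix.det_fin_two] at h2
    simp only [Matrix.of_apply, Matrix.cons_val', Matrix.cons_val_zero, Matrix.cons_val_one,
      Matrix.cons_val_fin_one] at h0 h1 h2
    have e : (a : ℂ) * b - (x + I * c) * (x - I * c) = ((a * b - (x ^ 2 + c ^ 2) : ℝ) : ℂ) := by
      push_cast
      linear_combination (c : ℂ) ^ 2 * I_sq
    rw [e] at h2
    exact ⟨by exact_mod_cast h0, by exact_mod_cast h1, sub_nonneg.mp (by exact_mod_cast h2)⟩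
  · rintro ⟨ha, hb, hd⟩
    refine Matrix.PosSemidef.of_dotProduct_mulVec_nonneg ?_ fun v => ?_
    · ext i j
      fin_cases i <;> fin_cases j <;> simp [Matrix.conjTranspose_apply, sub_eq_add_neg]
    · have e : star v ⬝ᵥ (!![(a : ℂ), x + I * c; x - I * c, b] *ᵥ v) =
          ((a * ((v 0).re ^ 2 + (v 0).im ^ 2) + b * ((v 1).re ^ 2 + (v 1).im ^ 2)
            + 2 * x * ((v 0).re * (v 1).re + (v 0).im * (v 1).im)
            + 2 * c * ((v 0).im * (v 1).re - (v 0).re * (v 1).im) : ℝ) : ℂ) := by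
        apply Complex.ext <;>
          simp [Matrix.mulVec, dotProduct, Fin.sum_univ_two, pow_two] <;> ring
      rw [e]
      norm_cast
      generalize (v 0).re = p, (v 0).im = q, (v 1).re = r, (v 1).im = s
      rcases ha.eq_or_lt with rfl | ha
      · have hx : x = 0 := by nlinarith [sq_nonneg x, sq_nonneg c]
        have hc : c = 0 := by nlinarith [sq_nonneg x, sq_nonneg c]
        subst hx hc
        nlinarith [mul_nonneg hb (add_nonneg (sq_nonneg r) (sq_nonneg s))]
      · refine (mul_nonneg_iff_of_pos_left ha).1 ?_
        nlinarith [sq_nonneg (a * p + x * r - c * s), sq_nonneg (a * q + x * s + c * r),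
          mul_nonneg (sub_nonneg.mpr hd) (add_nonneg (sq_nonneg r) (sq_nonneg s))]

theorem posSemidef_add_and_sub_iff (a x b c : ℝ) :
    ((!![a, x; x, b]).map Complex.ofReal + I • (c • Δ₂).map Complex.ofReal).PosSemidef ∧
      ((!![a, x; x, b]).map Complex.ofReal - I • (c • Δ₂).map Complex.ofReal).PosSemidef ↔
      0 ≤ a ∧ 0 ≤ b ∧ x ^ 2 + c ^ 2 ≤ a * b := by
  have e₁ : (!![a, x; x, b]).map Complex.ofReal + I • (c • Δ₂).map Complex.ofReal =
      !![(a : ℂ), x + I * c; x - I * c, b] := by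
    ext i j
    fin_cases i <;> fin_cases j <;> simp [Δ₂, sub_eq_add_neg]
  have e₂ : (!![a, x; x, b]).map Complex.ofReal - I • (c • Δ₂).map Complex.ofReal =
      !![(a : ℂ), x + I * (-c : ℝ); x - I * (-c : ℝ), b] := by
    ext i j
    fin_cases i <;> fin_cases j <;> simp [Δ₂, sub_eq_add_neg]
  rw [e₁, e₂, posSemidef_fin_two_iff, posSemidef_fin_two_iff, neg_sq, and_self]

theorem geqPMiDelta_iff (a x b : ℝ) :
    GeqPMiDelta !![a, x; x, b] ↔ 0 ≤ a ∧ 0 ≤ b ∧ x ^ 2 + 1 ≤ a * b := by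
  simpa [GeqPMiDelta] using posSemidef_add_and_sub_iff a x b 1

theorem mul_Δ₂_mul_transpose (K : Matrix (Fin 2) (Fin 2) ℝ) : K * Δ₂ * Kᵀ = K.det • Δ₂ := by
  ext i j
  fin_cases i <;> fin_cases j <;>
    simp [Δ₂, Matrix.mul_apply, Fin.sum_univ_two, Matrix.det_fin_two] <;> ring

theorem le_of_forall_pos_le_quadratic {m c₀ c₁ c₂ : ℝ}
    (h : ∀ t : ℝ, 0 < t → m ≤ c₀ + c₁ * t + c₂ * t ^ 2) : m ≤ c₀ := by
  have hc : Filter.Tendsto (fun t : ℝ => c₀ + c₁ * t + c₂ * t ^ 2)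
      (nhdsWithin 0 (Set.Ioi 0)) (nhds c₀) := by
    have : Continuous fun t : ℝ => c₀ + c₁ * t + c₂ * t ^ 2 := by fun_prop
    simpa using (this.tendsto 0).mono_left nhdsWithin_le_nhds
  exact ge_of_tendsto hc (by filter_upwards [self_mem_nhdsWithin] with t ht using h t ht)

/-- The positivity condition in terms of matrix entries. -/
theorem PosCond.entries {p q r s A X B : ℝ} (h : PosCond !![p, q; r, s] !![A, X; X, B])
    {a x b : ℝ} (ha : 0 ≤ a) (hb : 0 ≤ b) (hd : x ^ 2 + 1 ≤ a * b) :
    (p * r * a + (p * s + q * r) * x + q * s * b + X) ^ 2 + 1 ≤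
      (p ^ 2 * a + 2 * p * q * x + q ^ 2 * b + A) *
        (r ^ 2 * a + 2 * r * s * x + s ^ 2 * b + B) := by
  have hσ : IsQCM !![a, x; x, b] := by
    refine ⟨?_, (geqPMiDelta_iff a x b).2 ⟨ha, hb, hd⟩⟩
    ext i j
    fin_cases i <;> fin_cases j <;> simp
  have e : !![p, q; r, s] * !![a, x; x, b] * (!![p, q; r, s])ᵀ + !![A, X; X, B] =
      !![p ^ 2 * a + 2 * p * q * x + q ^ 2 * b + A,
          p * r * a + (p * s + q * r) * x + q * s * b + X;
        p * r * a + (p * s + q * r) * x + q * s * b + X,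
          r ^ 2 * a + 2 * r * s * x + s ^ 2 * b + B] := by
    ext i j
    fin_cases i <;> fin_cases j <;>
      simp [Matrix.vecMul, dotProduct, Fin.sum_univ_two] <;> ring
  have := h _ hσ
  rw [e, geqPMiDelta_iff] at this
  exact this.2.2

theorem PosCond.one_le_det_of_det_eq_zero {p q r s A X B : ℝ}
    (h : PosCond !![p, q; r, s] !![A, X; X, B]) (hK : p * s - q * r = 0) :
    1 ≤ A * B - X ^ 2 := by
  obtain hk | hk := (by positivity : 0 ≤ p ^ 2 + q ^ 2 + r ^ 2 + s ^ 2).eq_or_lt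
  · have hp : p = 0 := by nlinarith [sq_nonneg p, sq_nonneg q, sq_nonneg r, sq_nonneg s]
    have hq : q = 0 := by nlinarith [sq_nonneg p, sq_nonneg q, sq_nonneg r, sq_nonneg s]
    have hr : r = 0 := by nlinarith [sq_nonneg p, sq_nonneg q, sq_nonneg r, sq_nonneg s]
    have hs : s = 0 := by nlinarith [sq_nonneg p, sq_nonneg q, sq_nonneg r, sq_nonneg s]
    subst hp hq hr hs
    have := h.entries (a := 1) (x := 0) (b := 1) (by norm_num) (by norm_num) (by norm_num)
    linarith
  · refine le_of_forall_pos_le_quadratic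
      (c₁ := A * (r ^ 2 + s ^ 2) + B * (p ^ 2 + q ^ 2) - 2 * X * (p * r + q * s))
      (c₂ := (p * s - q * r) ^ 2) fun t ht => ?_
    set k := p ^ 2 + q ^ 2 + r ^ 2 + s ^ 2 with hkdef
    -- The test matrix is `(t k)⁻¹ • adj K * (adj K)ᵀ + t • 1`.
    set u := (t * k)⁻¹ with hu
    have hu0 : 0 < u := by positivity
    have hut : u * t * k = 1 := by rw [hu]; field_simp
    have := h.entries (a := u * (s ^ 2 + q ^ 2) + t) (x := -u * (s * r + q * p))
      (b := u * (r ^ 2 + p ^ 2) + t) (by positivity) (by positivity) (by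
        have : (u * (s ^ 2 + q ^ 2) + t) * (u * (r ^ 2 + p ^ 2) + t)
            - (-u * (s * r + q * p)) ^ 2 = 1 + t ^ 2 := by
          linear_combination hut + u ^ 2 * (p * s - q * r) * hK
        nlinarith [sq_nonneg t])
    have e₁ : p * r * (u * (s ^ 2 + q ^ 2) + t) + (p * s + q * r) * (-u * (s * r + q * p))
        + q * s * (u * (r ^ 2 + p ^ 2) + t) + X = t * (p * r + q * s) + X := by
      ring
    have e₂ : p ^ 2 * (u * (s ^ 2 + q ^ 2) + t) + 2 * p * q * (-u * (s * r + q * p))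
        + q ^ 2 * (u * (r ^ 2 + p ^ 2) + t) + A = t * (p ^ 2 + q ^ 2) + A := by
      linear_combination u * (p * s - q * r) * hK
    have e₃ : r ^ 2 * (u * (s ^ 2 + q ^ 2) + t) + 2 * r * s * (-u * (s * r + q * p))
        + s ^ 2 * (u * (r ^ 2 + p ^ 2) + t) + B = t * (r ^ 2 + s ^ 2) + B := by
      linear_combination u * (p * s - q * r) * hK
    rw [e₁, e₂, e₃] at this
    linarith

theorem PosCond.one_sub_det_sq_le_det {p q r s A X B : ℝ}
    (h : PosCond !![p, q; r, s] !![A, X; X, B]) (hA : 0 ≤ A) (hB : 0 ≤ B) (hα : X ^ 2 ≤ A * B)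
    (hK₀ : 0 < p * s - q * r) (hK₁ : p * s - q * r ≤ 1) :
    (1 - (p * s - q * r)) ^ 2 ≤ A * B - X ^ 2 := by
  refine le_of_forall_pos_le_quadratic (c₁ := A + B) (c₂ := 1) fun t ht => ?_
  obtain ⟨d, hd⟩ : ∃ d, d = p * s - q * r := ⟨_, rfl⟩
  rw [← hd] at hK₀ hK₁ ⊢
  have hD : 0 < (A + t) * (B + t) - X ^ 2 := by
    nlinarith [mul_nonneg hA ht.le, mul_nonneg hB ht.le, mul_pos ht ht]
  obtain ⟨c, hc, hcD⟩ : ∃ c : ℝ, 0 < c ∧ c ^ 2 = (A + t) * (B + t) - X ^ 2 :=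
    ⟨_, Real.sqrt_pos.2 hD, Real.sq_sqrt hD.le⟩
  -- The test matrix is `(d c)⁻¹ • adj K * (α + t • 1) * (adj K)ᵀ`.
  obtain ⟨u, hu0, hu⟩ : ∃ u : ℝ, 0 < u ∧ u * (d * c) = 1 :=
    ⟨(d * c)⁻¹, by positivity, inv_mul_cancel₀ (by positivity)⟩
  have hquad (y z : ℝ) : 0 ≤ u * (y ^ 2 * (A + t) + 2 * y * z * X + z ^ 2 * (B + t)) := by
    refine mul_nonneg hu0.le ((mul_nonneg_iff_of_pos_left (by positivity : 0 < A + t)).1 ?_)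
    nlinarith [sq_nonneg ((A + t) * y + X * z), mul_nonneg hD.le (sq_nonneg z)]
  have := h.entries (hquad s (-q)) (hquad (-r) p)
    (x := u * (-s * r * (A + t) + (s * p + q * r) * X - q * p * (B + t))) (by
      refine le_of_eq ?_
      have : u ^ 2 * d ^ 2 * ((A + t) * (B + t) - X ^ 2) = 1 := by
        rw [← hcD]
        linear_combination (u * (d * c) + 1) * hu
      rw [hd] at this
      linear_combination -this)
  have hv0 : 0 < u * d ^ 2 := by positivity
  have hvc : u * d ^ 2 * c = d := by linear_combination d * hu
  obtain ⟨v, hv⟩ : ∃ v, v = u * d ^ 2 := ⟨_, rfl⟩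
  rw [← hv] at hv0 hvc
  have hv' := hv
  rw [hd] at hv'
  have main : (v * X + X) ^ 2 + 1 ≤ (v * (A + t) + A) * (v * (B + t) + B) := by
    rw [hv']
    linear_combination this
  have key : 1 ≤ (c + d) ^ 2 := by
    have : (c + d) ^ 2 = (1 + v) ^ 2 * ((A + t) * (B + t) - X ^ 2) := by
      rw [← hcD, ← hvc]
      ring
    have htr : 0 ≤ t * ((v * (A + t) + A) + (v * (B + t) + B)) := by positivity
    rw [this]
    linear_combination main + htr + sq_nonneg t
  have hcd : 1 - d ≤ c := by
    linarith [(one_le_sq_iff₀ (by positivity : 0 ≤ c + d)).1 key]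
  linear_combination pow_le_pow_left₀ (sub_nonneg.2 hK₁) hcd 2 + hcD

/-- If `0 ≤ det K ≤ 1` and `(K, α)` satisfies the positivity condition, then
`(K, α)` satisfies the CP condition. -/
theorem stmt8 (K α : Matrix (Fin 2) (Fin 2) ℝ) (hα : α.PosSemidef)
    (hK0 : 0 ≤ K.det) (hK1 : K.det ≤ 1) (h : PosCond K α) :
    CPCond K α := by
  have hsymm : α 1 0 = α 0 1 := by simpa using hα.isHermitian.apply 0 1
  have eα : α = !![α 0 0, α 0 1; α 0 1, α 1 1] := by
    conv_lhs => rw [Matrix.eta_fin_two α, hsymm]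
  have hA : 0 ≤ α 0 0 := hα.diag_nonneg
  have hB : 0 ≤ α 1 1 := hα.diag_nonneg
  have hdet := hα.det_nonneg
  rw [Matrix.det_fin_two, hsymm] at hdet
  have hent := h
  rw [eα, Matrix.eta_fin_two K] at hent
  have hbound : (1 - K.det) ^ 2 ≤ α 0 0 * α 1 1 - α 0 1 ^ 2 := by
    rw [Matrix.det_fin_two] at hK0 hK1 ⊢
    obtain hK | hK := hK0.eq_or_lt
    · rw [← hK]
      simpa using hent.one_le_det_of_det_eq_zero hK.symm
    · exact hent.one_sub_det_sq_le_det hA hB (by linarith) hK hK1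
  have e : Δ₂ - K * Δ₂ * Kᵀ = (1 - K.det) • Δ₂ := by
    rw [mul_Δ₂_mul_transpose, sub_smul, one_smul]
  rw [CPCond, e, eα]
  exact (posSemidef_add_and_sub_iff _ _ _ _).2 ⟨hA, hB, by linarith⟩
end

section
/- Let n = 1, so all matrices are 2×2. Let K be a real 2×2 matrix with −1 ≤ det K < 0 and α a real symmetric positive semidefinite 2×2 matrix such that the pair (K,α) satisfies the positivity condition. Then the pair (K·T, α) satisfies the CP condition; since K = (K·T)·T, the map decomposes as the transposition followed by a completely positive map. -/
open Matrix Complex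
open scoped ComplexOrder

/-- A real positive semidefinite `2 × 2` matrix whose determinant dominates `s ^ 2` dominates
`i s Δ`. -/
lemma posSemidef_add_I_smul {σ : Matrix (Fin 2) (Fin 2) ℝ} (hσ : σ.PosSemidef) {s : ℝ}
    (hs : s ^ 2 ≤ σ.det) :
    (σ.map Complex.ofReal + Complex.I • (s • Δ₂).map Complex.ofReal).PosSemidef := by
  have h0 : 0 ≤ σ 0 0 := hσ.diag_nonneg
  have h1 : 0 ≤ σ 1 1 := hσ.diag_nonneg
  have h10 : σ 1 0 = σ 0 1 := by simpa using hσ.1.apply 0 1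
  rw [Matrix.det_fin_two, h10] at hs
  refine Matrix.PosSemidef.of_dotProduct_mulVec_nonneg ?_ fun x => ?_
  · ext i j
    fin_cases i <;> fin_cases j <;> simp [Δ₂, h10]
  · rw [Complex.nonneg_iff]
    simp only [dotProduct, mulVec, Fin.sum_univ_two, Δ₂, Matrix.add_apply, Matrix.smul_apply,
      Matrix.map_apply, Pi.star_apply, h10]
    simp
    generalize σ 0 0 = a at *
    generalize σ 0 1 = b at *
    generalize σ 1 1 = c at *
    generalize (x 0).re = p
    generalize (x 0).im = q
    generalize (x 1).re = r
    generalize (x 1).im = t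
    constructor
    · rcases h0.eq_or_lt with rfl | ha
      · have hb : b = 0 := by nlinarith [sq_nonneg b, sq_nonneg s]
        have hs0 : s = 0 := by nlinarith [sq_nonneg b, sq_nonneg s]
        subst hb hs0
        nlinarith [mul_nonneg h1 (sq_nonneg r), mul_nonneg h1 (sq_nonneg t)]
      · refine nonneg_of_mul_nonneg_right ?_ ha
        nlinarith [sq_nonneg (a * p + b * r - s * t), sq_nonneg (a * q + b * t + s * r),
          mul_nonneg (sub_nonneg.2 hs) (add_nonneg (sq_nonneg r) (sq_nonneg t))]
    · ring

lemma posSemidef_sub_I_smul {σ : Matrix (Fin 2) (Fin 2) ℝ} (hσ : σ.PosSemidef) {s : ℝ}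
    (hs : s ^ 2 ≤ σ.det) :
    (σ.map Complex.ofReal - Complex.I • (s • Δ₂).map Complex.ofReal).PosSemidef := by
  convert posSemidef_add_I_smul hσ (s := -s) (by simpa using hs) using 1
  ext i j
  simp [sub_eq_add_neg]

lemma isQCM_of_one_le_det {σ : Matrix (Fin 2) (Fin 2) ℝ} (hσ : σ.PosSemidef)
    (hs : 1 ≤ σ.det) : IsQCM σ := by
  refine ⟨by simpa [IsSymm, IsHermitian] using hσ.1, ?_, ?_⟩
  · simpa using posSemidef_add_I_smul hσ (s := 1) (by simpa using hs)
  · simpa using posSemidef_sub_I_smul hσ (s := 1) (by simpa using hs)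

lemma GeqPMiDelta.one_le_det {σ : Matrix (Fin 2) (Fin 2) ℝ} (h : GeqPMiDelta σ)
    (hσ : σ 1 0 = σ 0 1) : 1 ≤ σ.det := by
  have hd := (Complex.nonneg_iff.1 h.1.det_nonneg).1
  simp [Matrix.det_fin_two, Δ₂, hσ] at hd
  rw [Matrix.det_fin_two, hσ]
  linarith

/-- Conjugation by a `2 × 2` matrix scales the symplectic form by the determinant. -/
lemma mul_symplectic_mul_transpose (A : Matrix (Fin 2) (Fin 2) ℝ) :
    A * Δ₂ * Aᵀ = A.det • Δ₂ := by
  ext i j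
  fin_cases i <;> fin_cases j <;>
    simp [Matrix.mul_apply, Fin.sum_univ_two, Δ₂, Matrix.det_fin_two] <;> ring

/-- The positivity condition tested on the covariance matrix `σ` for which `K σ Kᵀ` is
proportional to a given positive definite `β`. -/
lemma PosCond.one_le_det_add_smul {K α β : Matrix (Fin 2) (Fin 2) ℝ} (h : PosCond K α)
    (hK : K.det < 0) (hα : α.PosSemidef) (hβ : β.PosSemidef) {d : ℝ} (hd : 0 < d)
    (hdβ : β.det = d ^ 2) : 1 ≤ (α + (-K.det / d) • β).det := by
  have hk : 0 < -K.det * d := mul_pos (neg_pos.2 hK) hd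
  have hK0 : K.det ≠ 0 := hK.ne
  have hσ : ((-K.det * d)⁻¹ • (K.adjugate * β * K.adjugateᵀ)).PosSemidef :=
    (by simpa using hβ.mul_mul_conjTranspose_same K.adjugate :
      (K.adjugate * β * K.adjugateᵀ).PosSemidef).smul (inv_nonneg.2 hk.le)
  have hdet : ((-K.det * d)⁻¹ • (K.adjugate * β * K.adjugateᵀ)).det = 1 := by
    simp only [Matrix.det_smul, Matrix.det_mul, Matrix.det_transpose, Matrix.det_adjugate,
      Fintype.card_fin, hdβ]
    field_simp
    norm_num
  have key : K * ((-K.det * d)⁻¹ • (K.adjugate * β * K.adjugateᵀ)) * Kᵀ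
      = (-K.det / d) • β := by
    have : K * (K.adjugate * β * K.adjugateᵀ) * Kᵀ
        = (K * K.adjugate) * β * (K * K.adjugate)ᵀ := by
      simp only [Matrix.transpose_mul, Matrix.mul_assoc]
    rw [Matrix.mul_smul, Matrix.smul_mul, this, Matrix.mul_adjugate]
    simp only [Matrix.transpose_smul, Matrix.transpose_one, Matrix.smul_mul, Matrix.mul_smul,
      Matrix.one_mul, Matrix.mul_one, smul_smul]
    congr 1
    field_simp
  have hG := h _ (isQCM_of_one_le_det hσ hdet.ge)
  rw [key, add_comm] at hG
  refine hG.one_le_det ?_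
  have e1 : α 1 0 = α 0 1 := by simpa using hα.1.apply 0 1
  have e2 : β 1 0 = β 0 1 := by simpa using hβ.1.apply 0 1
  simp [e1, e2]

lemma PosCond.sq_one_add_det_le_det {K α : Matrix (Fin 2) (Fin 2) ℝ} (h : PosCond K α)
    (hα : α.PosSemidef) (hK0 : -1 ≤ K.det) (hK1 : K.det < 0) : (1 + K.det) ^ 2 ≤ α.det := by
  have h0 : 0 ≤ α 0 0 := hα.diag_nonneg
  have h1 : 0 ≤ α 1 1 := hα.diag_nonneg
  have hdα : 0 ≤ α.det := hα.det_nonneg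
  have det_add (t : ℝ) : (α + t • (1 : Matrix (Fin 2) (Fin 2) ℝ)).det
      = α.det + t * (α 0 0 + α 1 1) + t ^ 2 := by
    simp [Matrix.det_fin_two]; ring
  have hε : ∀ ε : ℝ, 0 < ε → (1 + K.det) ^ 2 ≤ α.det + ε * (α 0 0 + α 1 1) + ε ^ 2 := by
    intro ε hε
    have hβ : (α + ε • (1 : Matrix (Fin 2) (Fin 2) ℝ)).PosSemidef :=
      hα.add (Matrix.PosSemidef.one.smul hε.le)
    have hpos : 0 < (α + ε • (1 : Matrix (Fin 2) (Fin 2) ℝ)).det := by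
      rw [det_add]; positivity
    have hd := Real.sqrt_pos.2 hpos
    have hsq := Real.sq_sqrt hpos.le
    set d := √(α + ε • (1 : Matrix (Fin 2) (Fin 2) ℝ)).det
    have hle := h.one_le_det_add_smul hK1 hα hβ hd hsq.symm
    rw [det_add] at hsq
    have hu : 0 < -K.det / d := div_pos (neg_pos.2 hK1) hd
    have hud : -K.det / d * d = -K.det := div_mul_cancel₀ _ hd.ne'
    set u := -K.det / d
    have hexp : (α + u • (α + ε • (1 : Matrix (Fin 2) (Fin 2) ℝ))).det
        = (1 + u) ^ 2 * α.det + (1 + u) * (u * ε) * (α 0 0 + α 1 1) + (u * ε) ^ 2 := by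
      simp [Matrix.det_fin_two]; ring
    have hmono : (1 + u) ^ 2 * α.det + (1 + u) * (u * ε) * (α 0 0 + α 1 1) + (u * ε) ^ 2
        ≤ (1 + u) ^ 2 * α.det + (1 + u) * ((1 + u) * ε) * (α 0 0 + α 1 1)
          + ((1 + u) * ε) ^ 2 := by
      gcongr <;> linarith
    have hbound : 1 ≤ (d - K.det) ^ 2 := by
      calc (1 : ℝ) ≤ ((1 + u) * d) ^ 2 := by
            rw [mul_pow, hsq]; linarith
        _ = (d - K.det) ^ 2 := by rw [add_mul, hud]; ring
    have : 1 + K.det ≤ d := by nlinarith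
    rw [← hsq]
    gcongr
    linarith
  have hc : Filter.Tendsto (fun ε : ℝ => α.det + ε * (α 0 0 + α 1 1) + ε ^ 2)
      (nhdsWithin 0 (Set.Ioi 0)) (nhds α.det) := by
    have : Continuous fun ε : ℝ => α.det + ε * (α 0 0 + α 1 1) + ε ^ 2 := by fun_prop
    simpa using (this.tendsto 0).mono_left nhdsWithin_le_nhds
  exact ge_of_tendsto hc (Filter.eventually_of_mem self_mem_nhdsWithin hε)

/-- If `-1 ≤ det K < 0` and `(K, α)` satisfies the positivity condition, then
`(K·T, α)` satisfies the CP condition (and `K = (K·T)·T`). -/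
theorem stmt9 (K α : Matrix (Fin 2) (Fin 2) ℝ) (hα : α.PosSemidef)
    (hK0 : -1 ≤ K.det) (hK1 : K.det < 0) (h : PosCond K α) :
    CPCond (K * T₂) α ∧ K = (K * T₂) * T₂ := by
  have hT : T₂ * T₂ = 1 := by
    ext i j
    fin_cases i <;> fin_cases j <;> simp [T₂]
  have hdT : T₂.det = -1 := by simp [T₂]
  have hΔ : Δ₂ - K * T₂ * Δ₂ * (K * T₂)ᵀ = (1 + K.det) • Δ₂ := by
    rw [mul_symplectic_mul_transpose, Matrix.det_mul, hdT, add_smul, one_smul, mul_neg_one,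
      neg_smul, sub_neg_eq_add]
  have hdet := h.sq_one_add_det_le_det hα hK0 hK1
  refine ⟨?_, by rw [Matrix.mul_assoc, hT, Matrix.mul_one]⟩
  rw [CPCond, hΔ]
  exact ⟨posSemidef_add_I_smul hα hdet, posSemidef_sub_I_smul hα hdet⟩
end
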